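/- For every integer j ∈ ℤ and every integer n ≥ 0, the q-factorial {n}_q! divides the shifted product {j}_{q,n} = (q^j − 1)(q^{j−1} − 1)⋯(q^{j−n+1} − 1) in ℤ[q,q^{-1}]. Consequently the generalized Gaussian binomial [j choose n]_q = {j}_{q,n}/{n}_q! is an element of ℤ[q,q^{-1}] for every integer j (possibly negative). -/

import Mathlib

open LaurentPolynomial Finset

/-- `{i}_q = q^i - 1` in `ℤ[q,q⁻¹]`. -/
noncomputable def qInt (i : ℤ) : LaurentPolynomial ℤ := T i - 1

/-- `{i}_{q,n} = {i}_q {i-1}_q ⋯ {i-n+1}_q`. -/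
noncomputable def qShift (i : ℤ) (n : ℕ) : LaurentPolynomial ℤ :=
  ∏ r ∈ Finset.range n, qInt (i - r)

/-- `{n}_q! = {n}_{q,n}`. -/
noncomputable def qFact (n : ℕ) : LaurentPolynomial ℤ := qShift n n

theorem qShift_succ (i : ℤ) (n : ℕ) : qShift i (n + 1) = qShift i n * qInt (i - n) :=
  Finset.prod_range_succ _ _

theorem qShift_add_one_succ (i : ℤ) (n : ℕ) :
    qShift (i + 1) (n + 1) = qInt (i + 1) * qShift i n := by
  simp only [qShift, Finset.prod_range_succ', Nat.cast_add, Nat.cast_one, add_sub_add_right_eq_sub,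
    Nat.cast_zero, sub_zero, mul_comm]

theorem qFact_succ (n : ℕ) : qFact (n + 1) = qInt (n + 1) * qFact n := by
  simpa [qFact] using qShift_add_one_succ n n

/-- The Pascal recurrence for shifted products. -/
theorem qShift_add_one_sub (i : ℤ) (n : ℕ) :
    qShift (i + 1) (n + 1) - qShift i (n + 1) = T (i - n) * (qInt (n + 1) * qShift i n) := by
  have h : (T (i + 1) : LaurentPolynomial ℤ) = T (i - n) * T (n + 1) := by
    rw [← T_add]
    congr 1
    ring
  rw [qShift_add_one_succ, qShift_succ]
  simp only [qInt, h]
  ring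

/-- For every `j ∈ ℤ` and `n ≥ 0`, the `q`-factorial `{n}_q!` divides the shifted
product `{j}_{q,n}` in `ℤ[q,q⁻¹]`; hence the generalized Gaussian binomial
`[j choose n]_q = {j}_{q,n}/{n}_q!` lies in `ℤ[q,q⁻¹]`. -/
theorem qFact_dvd_qShift (j : ℤ) (n : ℕ) : qFact n ∣ qShift j n := by
  induction n generalizing j with
  | zero => simp [qFact, qShift]
  | succ n ih =>
    have step (i : ℤ) : qFact (n + 1) ∣ qShift (i + 1) (n + 1) - qShift i (n + 1) := by
      rw [qShift_add_one_sub, qFact_succ]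
      exact (mul_dvd_mul_left _ (ih i)).mul_left _
    induction j using Int.induction_on with
    | zero => simp [qShift, Finset.prod_range_succ', qInt]
    | succ i hi => exact (dvd_iff_dvd_of_dvd_sub (step i)).mpr hi
    | pred i hi =>
      have h := step (-i - 1)
      rw [sub_add_cancel] at h
      exact (dvd_iff_dvd_of_dvd_sub h).mp hi
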